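/- Every pretopos is diexact; that is, if a category C is finitely complete, extensive and Barr-exact, then every Mal'cev span in C admits a pushout, and every such pushout square is stable under pullback and is itself a pullback square. -/

import Mathlib

open CategoryTheory CategoryTheory.Limits

universe v u

section Defs

variable {C : Type u} [Category.{v} C]

/-- A span `(f, g)` is *jointly monic* if `u ≫ f = v ≫ f` and `u ≫ g = v ≫ g` imply `u = v`
(equivalently, the induced map into the product is a monomorphism). -/
def JointlyMonic {Z A B : C} (f : Z ⟶ A) (g : Z ⟶ B) : Prop :=
  ∀ ⦃X : C⦄ (u v : X ⟶ Z), u ≫ f = v ≫ f → u ≫ g = v ≫ g → u = v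

/-- `(P, π₁, π₂, π₃)` is the limit `C ×_B C ×_A C` of triples `(c₁, c₂, c₃)` of generalized
elements of `Z` with `g ∘ π₁ = g ∘ π₂` and `f ∘ π₂ = f ∘ π₃`. -/
structure IsTripleLimit {Z A B : C} (f : Z ⟶ A) (g : Z ⟶ B) {P : C}
    (π₁ π₂ π₃ : P ⟶ Z) : Prop where
  w₁ : π₁ ≫ g = π₂ ≫ g
  w₂ : π₂ ≫ f = π₃ ≫ f
  lift : ∀ ⦃X : C⦄ (x₁ x₂ x₃ : X ⟶ Z), x₁ ≫ g = x₂ ≫ g → x₂ ≫ f = x₃ ≫ f →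
    ∃! u : X ⟶ P, u ≫ π₁ = x₁ ∧ u ≫ π₂ = x₂ ∧ u ≫ π₃ = x₃

/-- A jointly monic span `(f, g)` is a *Mal'cev span* if, for the limit
`P = C ×_B C ×_A C`, there exists `p : P ⟶ C` with `f ∘ p = f ∘ π₁` and `g ∘ p = g ∘ π₃`. -/
def IsMalcevSpan {Z A B : C} (f : Z ⟶ A) (g : Z ⟶ B) : Prop :=
  JointlyMonic f g ∧
  ∀ ⦃P : C⦄ (π₁ π₂ π₃ : P ⟶ Z), IsTripleLimit f g π₁ π₂ π₃ →
    ∃ p : P ⟶ Z, p ≫ f = π₁ ≫ f ∧ p ≫ g = π₃ ≫ g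

/-- A commuting square (with legs `f, g` and colegs `h, k`) is *stable under pullback* if
every commutative cube over it whose four side faces are pullbacks has a pushout top face. -/
def PushoutStable {Z A B D : C} (f : Z ⟶ A) (g : Z ⟶ B) (h : A ⟶ D) (k : B ⟶ D) : Prop :=
  ∀ ⦃Z' A' B' D' : C⦄ (f' : Z' ⟶ A') (g' : Z' ⟶ B') (h' : A' ⟶ D') (k' : B' ⟶ D')
    (αZ : Z' ⟶ Z) (αA : A' ⟶ A) (αB : B' ⟶ B) (αD : D' ⟶ D),
    IsPullback f' αZ αA f → IsPullback g' αZ αB g →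
    IsPullback h' αA αD h → IsPullback k' αB αD k →
    f' ≫ h' = g' ≫ k' → IsPushout f' g' h' k'

/-- A category is *diexact* if every Mal'cev span admits a pushout, and every pushout square
of a Mal'cev span is stable under pullback and is itself a pullback square. -/
def Diexact (C : Type u) [Category.{v} C] : Prop :=
  ∀ ⦃Z A B : C⦄ (f : Z ⟶ A) (g : Z ⟶ B), IsMalcevSpan f g →
    (∃ (D : C) (h : A ⟶ D) (k : B ⟶ D), IsPushout f g h k) ∧
    ∀ ⦃D : C⦄ (h : A ⟶ D) (k : B ⟶ D), IsPushout f g h k →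
      PushoutStable f g h k ∧ IsPullback f g h k

/-- An internal equivalence relation: a jointly monic pair which is reflexive, symmetric
and transitive. -/
def IsEquivRelation [HasPullbacks C] {E A : C} (s t : E ⟶ A) : Prop :=
  JointlyMonic s t ∧
  (∃ r : A ⟶ E, r ≫ s = 𝟙 A ∧ r ≫ t = 𝟙 A) ∧
  (∃ σ : E ⟶ E, σ ≫ s = t ∧ σ ≫ t = s) ∧
  (∃ τ : pullback t s ⟶ E,
     τ ≫ s = pullback.fst t s ≫ s ∧ τ ≫ t = pullback.snd t s ≫ t)

/-- A finitely complete category is *Barr-exact* if every kernel pair has a coequaliser,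
regular epimorphisms are stable under pullback, and every internal equivalence relation is
effective (i.e. a kernel pair). -/
def BarrExact (C : Type u) [Category.{v} C] [HasFiniteLimits C] : Prop :=
  (∀ ⦃X Y : C⦄ (f : X ⟶ Y), HasCoequalizer (pullback.fst f f) (pullback.snd f f)) ∧
  (∀ ⦃X Y W : C⦄ (f : X ⟶ Y) (g : W ⟶ Y),
     Nonempty (RegularEpi f) → Nonempty (RegularEpi (pullback.snd f g))) ∧
  (∀ ⦃E A : C⦄ (s t : E ⟶ A), IsEquivRelation s t →
     ∃ (Q : C) (q : A ⟶ Q), IsPullback s t q q)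

/-- A category is *amalgamable* if every span of monomorphisms admits a pushout which is
stable under pullback and is itself a pullback square. -/
def Amalgamable (C : Type u) [Category.{v} C] : Prop :=
  ∀ ⦃Z A B : C⦄ (f : Z ⟶ A) (g : Z ⟶ B), Mono f → Mono g →
    ∃ (D : C) (h : A ⟶ D) (k : B ⟶ D),
      IsPushout f g h k ∧ PushoutStable f g h k ∧ IsPullback f g h k

/-- A category is *adhesive* if it admits pushouts along monomorphisms, and these pushouts
are stable under pullback and are pullback squares. -/
def AdhesiveCat (C : Type u) [Category.{v} C] : Prop :=
  ∀ ⦃Z A B : C⦄ (f : Z ⟶ A) (g : Z ⟶ B), Mono f →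
    (∃ (D : C) (h : A ⟶ D) (k : B ⟶ D), IsPushout f g h k) ∧
    ∀ ⦃D : C⦄ (h : A ⟶ D) (k : B ⟶ D), IsPushout f g h k →
      PushoutStable f g h k ∧ IsPullback f g h k

/-- `u` factors through `v` (as morphisms into a common object `X`). -/
def FactorsThru {U V X : C} (u : U ⟶ X) (v : V ⟶ X) : Prop :=
  ∃ w : U ⟶ V, w ≫ v = u

/-- A monomorphism `m : P ⟶ X` is the *union* of the subobjects `a : A ⟶ X` and `b : B ⟶ X`:
both factor through `m`, and `m` factors through any monomorphism through which both factor. -/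
def IsUnionOf {A B P X : C} (a : A ⟶ X) (b : B ⟶ X) (m : P ⟶ X) : Prop :=
  Mono m ∧ FactorsThru a m ∧ FactorsThru b m ∧
  ∀ ⦃Q : C⦄ (c : Q ⟶ X), Mono c → FactorsThru a c → FactorsThru b c → FactorsThru m c

end Defs

/-! ### Local existence for a Grothendieck topology -/

section Locally

variable {C : Type u} [Category.{v} C]

/-- The property `P` of generalized elements of `W` holds on all members of some covering sieve. -/
def Locally (J : GrothendieckTopology C) {W : C} (P : ∀ ⦃V : C⦄, (V ⟶ W) → Prop) : Prop :=
  ∃ S ∈ J W, ∀ ⦃V : C⦄ (v : V ⟶ W), S v → P v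

namespace Locally

variable {J : GrothendieckTopology C} {W : C} {P Q : ∀ ⦃V : C⦄, (V ⟶ W) → Prop}

theorem of_forall (h : ∀ ⦃V : C⦄ (v : V ⟶ W), P v) : Locally J P :=
  ⟨⊤, J.top_mem W, fun _ v _ => h v⟩

theorem mono (hP : Locally J P) (h : ∀ ⦃V : C⦄ (v : V ⟶ W), P v → Q v) : Locally J Q := by
  obtain ⟨S, hS, hSP⟩ := hP
  exact ⟨S, hS, fun _ v hv => h v (hSP v hv)⟩

theorem and (hP : Locally J P) (hQ : Locally J Q) : Locally J fun _ v => P v ∧ Q v := by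
  obtain ⟨S, hS, hSP⟩ := hP
  obtain ⟨T, hT, hTQ⟩ := hQ
  exact ⟨S ⊓ T, J.intersection_covering hS hT, fun _ v hv => ⟨hSP v hv.1, hTQ v hv.2⟩⟩

theorem pullback {W' : C} (hP : Locally J P) (w : W' ⟶ W) : Locally J fun _ v => P (v ≫ w) := by
  obtain ⟨S, hS, hSP⟩ := hP
  exact ⟨S.pullback w, J.pullback_stable w hS, fun _ v hv => hSP (v ≫ w) hv⟩

theorem bind (hP : Locally J P)
    (h : ∀ ⦃V : C⦄ (v : V ⟶ W), P v → Locally J fun _ u => Q (u ≫ v)) : Locally J Q := by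
  obtain ⟨S, hS, hSP⟩ := hP
  choose R hR hRQ using fun (V : C) (v : V ⟶ W) (hv : S v) => h v (hSP v hv)
  refine ⟨Sieve.bind S fun V v hv => R V v hv, J.bind_covering hS fun V v hv => hR V v hv, ?_⟩
  rintro V _ ⟨U, u, w, hw, hu, rfl⟩
  exact hRQ _ _ hw u hu

theorem hom_ext [J.Subcanonical] {T : C} {x y : W ⟶ T}
    (h : Locally J fun _ v => v ≫ x = v ≫ y) : x = y := by
  obtain ⟨S, hS, hSP⟩ := h
  exact ((GrothendieckTopology.Subcanonical.isSheaf_of_isRepresentable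
    (J := J) (yoneda.obj T)) S hS).isSeparatedFor.ext fun _ v hv => hSP v hv

/-- Locally defined, locally unique morphisms into `T` glue when representables are sheaves. -/
theorem exists_glue [J.Subcanonical] {T : C} {R : ∀ ⦃V : C⦄, (V ⟶ W) → (V ⟶ T) → Prop}
    (stable : ∀ ⦃U V : C⦄ (u : U ⟶ V) (v : V ⟶ W) (t : V ⟶ T), R v t → R (u ≫ v) (u ≫ t))
    (unique : ∀ ⦃V : C⦄ (v : V ⟶ W) (t t' : V ⟶ T), R v t → R v t' → t = t')
    (h : Locally J fun _ v => ∃ t, R v t) :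
    ∃ t : W ⟶ T, ∀ ⦃V : C⦄ (v : V ⟶ W) (s : V ⟶ T), R v s → v ≫ t = s := by
  obtain ⟨S, hS, hSP⟩ := h
  choose x hx using hSP
  let x' : Presieve.FamilyOfElements (yoneda.obj T) S.arrows := fun V v hv => x v hv
  have hc : x'.Compatible := by
    rw [Presieve.compatible_iff_sieveCompatible]
    intro U V v u hv
    exact unique _ _ _ (hx _ _) (stable _ _ _ (hx _ _))
  obtain ⟨t, ht, -⟩ := (GrothendieckTopology.Subcanonical.isSheaf_of_isRepresentable
    (J := J) (yoneda.obj T)) S hS x' hc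
  refine ⟨t, fun V v s hs => hom_ext (J := J) ⟨S.pullback v, J.pullback_stable v hS, ?_⟩⟩
  intro U u hu
  have h₁ : (u ≫ v) ≫ t = x (u ≫ v) hu := ht (u ≫ v) hu
  rw [← Category.assoc, h₁]
  exact unique _ _ _ (hx _ _) (stable _ _ _ hs)

theorem exists_lift_of_jointlyMonic [J.Subcanonical] {Z A B : C} {f : Z ⟶ A} {g : Z ⟶ B}
    (hfg : JointlyMonic f g) {x : W ⟶ A} {y : W ⟶ B}
    (h : Locally J fun V v => ∃ z : V ⟶ Z, z ≫ f = v ≫ x ∧ z ≫ g = v ≫ y) :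
    ∃ z : W ⟶ Z, z ≫ f = x ∧ z ≫ g = y := by
  obtain ⟨t, ht⟩ := exists_glue (R := fun V v (z : V ⟶ Z) => z ≫ f = v ≫ x ∧ z ≫ g = v ≫ y)
    (fun U V u v t ht => by simp [ht.1, ht.2])
    (fun V v t t' h h' => hfg _ _ (h.1.trans h'.1.symm) (h.2.trans h'.2.symm)) h
  refine ⟨t, hom_ext (J := J) (h.mono ?_), hom_ext (J := J) (h.mono ?_)⟩
  · rintro V v ⟨z, hz⟩
    rw [← Category.assoc, ht v z hz, hz.1]
  · rintro V v ⟨z, hz⟩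
    rw [← Category.assoc, ht v z hz, hz.2]

end Locally

end Locally

/-! ### Squares exhibiting their corner as a glueing -/

section Glueing

variable {C : Type u} [Category.{v} C]

/-- A commutative square whose colegs are jointly locally surjective and such that two generalized
elements of `A` and `B` are identified in `D` only when the span locally forces it. -/
structure IsGlueing (J : GrothendieckTopology C) {Z A B D : C} (f : Z ⟶ A) (g : Z ⟶ B)
    (h : A ⟶ D) (k : B ⟶ D) : Prop where
  w : f ≫ h = g ≫ k
  cover : ∀ ⦃W : C⦄ (d : W ⟶ D),
    Locally J fun V v => (∃ x : V ⟶ A, x ≫ h = v ≫ d) ∨ ∃ y : V ⟶ B, y ≫ k = v ≫ d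
  left : ∀ ⦃W : C⦄ (x y : W ⟶ A), x ≫ h = y ≫ h → Locally J fun V v => v ≫ x = v ≫ y ∨
    ∃ z z' : V ⟶ Z, z ≫ f = v ≫ x ∧ z' ≫ f = v ≫ y ∧ z ≫ g = z' ≫ g
  right : ∀ ⦃W : C⦄ (x y : W ⟶ B), x ≫ k = y ≫ k → Locally J fun V v => v ≫ x = v ≫ y ∨
    ∃ z z' : V ⟶ Z, z ≫ g = v ≫ x ∧ z' ≫ g = v ≫ y ∧ z ≫ f = z' ≫ f
  cross : ∀ ⦃W : C⦄ (x : W ⟶ A) (y : W ⟶ B), x ≫ h = y ≫ k →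
    ∃ z : W ⟶ Z, z ≫ f = x ∧ z ≫ g = y

namespace IsGlueing

variable {J : GrothendieckTopology C} {Z A B D : C} {f : Z ⟶ A} {g : Z ⟶ B}
  {h : A ⟶ D} {k : B ⟶ D}

theorem flip (H : IsGlueing J f g h k) : IsGlueing J g f k h where
  w := H.w.symm
  cover _ d := (H.cover d).mono fun _ _ => Or.symm
  left := H.right
  right := H.left
  cross _ x y e := (H.cross y x e.symm).imp fun _ => And.symm

theorem comp_iso (H : IsGlueing J f g h k) {D' : C} (e : D ≅ D') :
    IsGlueing J f g (h ≫ e.hom) (k ≫ e.hom) where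
  w := by rw [← Category.assoc, H.w, Category.assoc]
  cover W d := (H.cover (d ≫ e.inv)).mono fun V v => by
    simp only [← Category.assoc, Iso.eq_comp_inv, imp_self]
  left W x y hxy := H.left x y (by simpa only [← Category.assoc, cancel_mono] using hxy)
  right W x y hxy := H.right x y (by simpa only [← Category.assoc, cancel_mono] using hxy)
  cross W x y hxy := H.cross x y (by simpa only [← Category.assoc, cancel_mono] using hxy)

theorem isPullback (H : IsGlueing J f g h k) (hfg : JointlyMonic f g) : IsPullback f g h k where
  w := H.w
  isLimit' := ⟨PullbackCone.IsLimit.mk H.w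
    (fun s => (H.cross s.fst s.snd s.condition).choose)
    (fun s => (H.cross s.fst s.snd s.condition).choose_spec.1)
    (fun s => (H.cross s.fst s.snd s.condition).choose_spec.2)
    (fun s _ h₁ h₂ => hfg _ _
      (h₁.trans (H.cross s.fst s.snd s.condition).choose_spec.1.symm)
      (h₂.trans (H.cross s.fst s.snd s.condition).choose_spec.2.symm))⟩

theorem comp_eq_of_comp_eq [J.Subcanonical] (H : IsGlueing J f g h k) {T : C} {a : A ⟶ T}
    {b : B ⟶ T} (hab : f ≫ a = g ≫ b) {W : C} {x y : W ⟶ A} (hxy : x ≫ h = y ≫ h) :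
    x ≫ a = y ≫ a := by
  refine Locally.hom_ext (J := J) ((H.left x y hxy).mono ?_)
  rintro V v (e | ⟨z, z', hx, hy, e⟩)
  · rw [← Category.assoc, e, Category.assoc]
  · rw [← Category.assoc, ← Category.assoc, ← hx, ← hy, Category.assoc, Category.assoc, hab,
      ← Category.assoc, e, Category.assoc]

theorem exists_desc [J.Subcanonical] (H : IsGlueing J f g h k) {T : C} {a : A ⟶ T} {b : B ⟶ T}
    (hab : f ≫ a = g ≫ b) : ∃ t : D ⟶ T, h ≫ t = a ∧ k ≫ t = b := by
  have cross : ∀ ⦃V : C⦄ (x : V ⟶ A) (y : V ⟶ B), x ≫ h = y ≫ k → x ≫ a = y ≫ b := by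
    intro V x y e
    obtain ⟨z, rfl, rfl⟩ := H.cross x y e
    rw [Category.assoc, hab, Category.assoc]
  obtain ⟨t, ht⟩ := Locally.exists_glue (J := J) (W := D) (T := T)
    (R := fun V v t => (∃ x : V ⟶ A, x ≫ h = v ∧ x ≫ a = t) ∨ ∃ y : V ⟶ B, y ≫ k = v ∧ y ≫ b = t)
    (by
      rintro U V u v t (⟨x, rfl, rfl⟩ | ⟨y, rfl, rfl⟩)
      · exact Or.inl ⟨u ≫ x, by simp, by simp⟩
      · exact Or.inr ⟨u ≫ y, by simp, by simp⟩)
    (by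
      rintro V v t t' (⟨x, hx, rfl⟩ | ⟨y, hy, rfl⟩) (⟨x', hx', rfl⟩ | ⟨y', hy', rfl⟩)
      · exact H.comp_eq_of_comp_eq hab (hx.trans hx'.symm)
      · exact cross _ _ (hx.trans hy'.symm)
      · exact (cross _ _ (hx'.trans hy.symm)).symm
      · exact H.flip.comp_eq_of_comp_eq hab.symm (hy.trans hy'.symm))
    ((H.cover (𝟙 D)).mono (by
      rintro V v (⟨x, hx⟩ | ⟨y, hy⟩)
      · exact ⟨x ≫ a, Or.inl ⟨x, by simpa using hx, rfl⟩⟩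
      · exact ⟨y ≫ b, Or.inr ⟨y, by simpa using hy, rfl⟩⟩))
  exact ⟨t, ht h a (Or.inl ⟨𝟙 A, by simp, by simp⟩), ht k b (Or.inr ⟨𝟙 B, by simp, by simp⟩)⟩

theorem hom_ext [J.Subcanonical] (H : IsGlueing J f g h k) {T : C} {s t : D ⟶ T}
    (hh : h ≫ s = h ≫ t) (hk : k ≫ s = k ≫ t) : s = t := by
  refine Locally.hom_ext (J := J) ((H.cover (𝟙 D)).mono ?_)
  rintro V v (⟨x, hx⟩ | ⟨y, hy⟩)
  · obtain rfl : x ≫ h = v := by simpa using hx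
    simp [hh]
  · obtain rfl : y ≫ k = v := by simpa using hy
    simp [hk]

theorem isPushout [J.Subcanonical] (H : IsGlueing J f g h k) : IsPushout f g h k where
  w := H.w
  isColimit' := ⟨PushoutCocone.IsColimit.mk H.w
    (fun s => (H.exists_desc s.condition).choose)
    (fun s => (H.exists_desc s.condition).choose_spec.1)
    (fun s => (H.exists_desc s.condition).choose_spec.2)
    (fun s _ h₁ h₂ => H.hom_ext
      (h₁.trans (H.exists_desc s.condition).choose_spec.1.symm)
      (h₂.trans (H.exists_desc s.condition).choose_spec.2.symm))⟩

section BaseChange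

variable {Z' A' B' D' : C} {f' : Z' ⟶ A'} {g' : Z' ⟶ B'} {h' : A' ⟶ D'} {k' : B' ⟶ D'}
  {αZ : Z' ⟶ Z} {αA : A' ⟶ A} {αB : B' ⟶ B} {αD : D' ⟶ D}

theorem left_of_isPullback (H : IsGlueing J f g h k) (hf : IsPullback f' αZ αA f)
    (hg : IsPullback g' αZ αB g) (hh : IsPullback h' αA αD h) (hk : IsPullback k' αB αD k)
    (w : f' ≫ h' = g' ≫ k') {W : C} (x y : W ⟶ A') (hxy : x ≫ h' = y ≫ h') :
    Locally J fun V v => v ≫ x = v ≫ y ∨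
      ∃ z z' : V ⟶ Z', z ≫ f' = v ≫ x ∧ z' ≫ f' = v ≫ y ∧ z ≫ g' = z' ≫ g' := by
  have hα : (x ≫ αA) ≫ h = (y ≫ αA) ≫ h := by
    simp only [Category.assoc, ← hh.w]
    rw [← Category.assoc, hxy, Category.assoc]
  refine (H.left _ _ hα).mono ?_
  rintro V v (e | ⟨z, z', hz, hz', e⟩)
  · exact Or.inl (hh.hom_ext (by simp [hxy]) (by simpa using e))
  · refine Or.inr ⟨hf.lift (v ≫ x) z (by simp [hz]), hf.lift (v ≫ y) z' (by simp [hz']),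
      by simp, by simp, hk.hom_ext ?_ ?_⟩
    · simp [← w, hxy]
    · simp [hg.w, e]

theorem of_isPullback (H : IsGlueing J f g h k) (hf : IsPullback f' αZ αA f)
    (hg : IsPullback g' αZ αB g) (hh : IsPullback h' αA αD h) (hk : IsPullback k' αB αD k)
    (w : f' ≫ h' = g' ≫ k') : IsGlueing J f' g' h' k' where
  w := w
  cover W d := (H.cover (d ≫ αD)).mono (by
    rintro V v (⟨x, hx⟩ | ⟨y, hy⟩)
    · exact Or.inl ⟨hh.lift (v ≫ d) x (by simp [hx]), by simp⟩
    · exact Or.inr ⟨hk.lift (v ≫ d) y (by simp [hy]), by simp⟩)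
  left W x y hxy := H.left_of_isPullback hf hg hh hk w x y hxy
  right W x y hxy := H.flip.left_of_isPullback hg hf hk hh w.symm x y hxy
  cross W x y hxy := by
    have hα : (x ≫ αA) ≫ h = (y ≫ αB) ≫ k := by
      simp only [Category.assoc, ← hh.w, ← hk.w]
      rw [← Category.assoc, hxy, Category.assoc]
    obtain ⟨z, hz, hz'⟩ := H.cross _ _ hα
    refine ⟨hf.lift x z hz.symm, by simp, hk.hom_ext ?_ ?_⟩
    · simp [← w, hxy]
    · simp [hg.w, hz']

end BaseChange

theorem pushoutStable [J.Subcanonical] (H : IsGlueing J f g h k) : PushoutStable f g h k :=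
  fun _ _ _ _ _ _ _ _ _ _ _ _ hf hg hh hk w => (H.of_isPullback hf hg hh hk w).isPushout

end IsGlueing

end Glueing

/-! ### Covers in extensive regular categories -/

section Coherent

variable {C : Type u} [Category.{v} C]

theorem locally_of_effectiveEpiFamily [Precoherent C] {ι : Type} [Finite ι] {B : C} {X : ι → C}
    {π : ∀ i, X i ⟶ B} (hπ : EffectiveEpiFamily X π) {W : C} (x : W ⟶ B) :
    Locally (coherentTopology C) fun V v => ∃ (i : ι) (y : V ⟶ X i), y ≫ π i = v ≫ x := by
  have h : Locally (coherentTopology C) fun V (v : V ⟶ B) =>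
      ∃ (i : ι) (y : V ⟶ X i), y ≫ π i = v := by
    refine ⟨Sieve.generate (Presieve.ofArrows X π),
      coherentTopology.mem_sieves_of_hasEffectiveEpiFamily _
        ⟨ι, inferInstance, X, π, hπ, fun i => Sieve.le_generate _ _ _ ⟨i⟩⟩, ?_⟩
    rintro V _ ⟨_, y, _, ⟨i⟩, rfl⟩
    exact ⟨i, y, rfl⟩
  exact h.pullback x

theorem locally_exists_lift [Precoherent C] {X Q : C} (q : X ⟶ Q) [EffectiveEpi q] {W : C}
    (x : W ⟶ Q) : Locally (coherentTopology C) fun V v => ∃ a : V ⟶ X, a ≫ q = v ≫ x :=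
  (locally_of_effectiveEpiFamily (X := fun _ : Unit => X) (π := fun _ => q) inferInstance x).mono
    fun _ _ ⟨_, a, ha⟩ => ⟨a, ha⟩

theorem locally_coprod [Precoherent C] [HasFiniteCoproducts C] {A B W : C} (x : W ⟶ A ⨿ B) :
    Locally (coherentTopology C) fun V v =>
      (∃ a : V ⟶ A, a ≫ coprod.inl = v ≫ x) ∨ ∃ b : V ⟶ B, b ≫ coprod.inr = v ≫ x := by
  let π : ∀ j, pairFunction A B j ⟶ A ⨿ B := fun
    | .left => coprod.inl
    | .right => coprod.inr
  have : IsIso (Sigma.desc π) := by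
    refine ⟨coprod.desc (Sigma.ι (pairFunction A B) .left) (Sigma.ι (pairFunction A B) .right),
      ?_, ?_⟩
    · refine Sigma.hom_ext _ _ ?_
      rintro (_ | _)
      · simp only [Sigma.ι_desc_assoc, Category.comp_id]
        exact coprod.inl_desc _ _
      · simp only [Sigma.ι_desc_assoc, Category.comp_id]
        exact coprod.inr_desc _ _
    · ext
      · rw [Category.comp_id]
        exact (coprod.inl_desc_assoc _ _ _).trans (Sigma.ι_desc π WalkingPair.left)
      · rw [Category.comp_id]
        exact (coprod.inr_desc_assoc _ _ _).trans (Sigma.ι_desc π WalkingPair.right)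
  refine (locally_of_effectiveEpiFamily (π := π) inferInstance x).mono ?_
  rintro V v ⟨_ | _, y, hy⟩
  · exact Or.inl ⟨y, hy⟩
  · exact Or.inr ⟨y, hy⟩

theorem locally_of_hom_initial [Precoherent C] [HasFiniteCoproducts C] {W : C} (x : W ⟶ ⊥_ C)
    {P : ∀ ⦃V : C⦄, (V ⟶ W) → Prop} : Locally (coherentTopology C) P := by
  let X : Empty → C := Empty.elim
  let π : ∀ i, X i ⟶ ⊥_ C := fun i => i.elim
  have : IsIso (Sigma.desc π) :=
    ⟨initial.to _, Sigma.hom_ext _ _ fun i => i.elim, initial.hom_ext _ _⟩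
  exact (locally_of_effectiveEpiFamily (π := π) inferInstance x).mono fun _ _ ⟨i, _⟩ => i.elim

theorem exists_hom_initial_of_inl_eq_inr [FinitaryExtensive C] {A B W : C} {a : W ⟶ A} {b : W ⟶ B}
    (h : a ≫ (coprod.inl : A ⟶ A ⨿ B) = b ≫ coprod.inr) : Nonempty (W ⟶ ⊥_ C) :=
  ⟨(FinitaryExtensive.isPullback_initial_to_binaryCofan (coprodIsCoprod A B)).lift a b h⟩

end Coherent

/-! ### Quotients by locally generated equivalence relations -/

section Quotient

variable {C : Type u} [Category.{v} C]

/-- The pair `(x, y)` locally lifts along `(s, t)`. -/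
def LocallyRelated (J : GrothendieckTopology C) {P X : C} (s t : P ⟶ X) {W : C} (x y : W ⟶ X) :
    Prop :=
  Locally J fun V v => ∃ p : V ⟶ P, p ≫ s = v ≫ x ∧ p ≫ t = v ≫ y

theorem BarrExact.regular [HasFiniteLimits C] (hC : BarrExact C) : Regular C where
  hasCoequalizer_of_isKernelPair {X Y Z f g₁ g₂} h := by
    have := hC.1 f
    obtain ⟨e, rfl, rfl⟩ : ∃ e : Z ≅ pullback f f,
        e.hom ≫ pullback.fst f f = g₁ ∧ e.hom ≫ pullback.snd f f = g₂ :=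
      ⟨h.isoPullback, h.isoPullback_hom_fst, h.isoPullback_hom_snd⟩
    refine ⟨⟨⟨Cofork.ofπ (coequalizer.π (pullback.fst f f) (pullback.snd f f))
      (by rw [Category.assoc, Category.assoc, coequalizer.condition]), Cofork.IsColimit.mk' _ fun s => ?_⟩⟩⟩
    have w : pullback.fst f f ≫ s.π = pullback.snd f f ≫ s.π := by
      simpa only [Category.assoc, cancel_epi] using s.condition
    exact ⟨coequalizer.desc s.π w, coequalizer.π_desc _ _,
      fun hm => coequalizer.hom_ext (hm.trans (coequalizer.π_desc _ _).symm)⟩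
  regularEpiIsStableUnderBaseChange := by
    refine MorphismProperty.IsStableUnderBaseChange.mk' fun X Y S f g _ hg => ?_
    rw [MorphismProperty.regularEpi_iff] at hg ⊢
    obtain ⟨r⟩ := hC.2.1 g f hg.1
    rw [← pullbackSymmetry_hom_comp_snd]
    exact (MorphismProperty.regularEpi C).cancel_left_of_respectsIso _ _ |>.mpr ⟨⟨r⟩⟩

theorem exists_jointlyMonic_image [FinitaryExtensive C] [Regular C] {P X : C} (s t : P ⟶ X) :
    ∃ (E : C) (a b : E ⟶ X), JointlyMonic a b ∧ ∀ ⦃W : C⦄ (x y : W ⟶ X),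
      (∃ e : W ⟶ E, e ≫ a = x ∧ e ≫ b = y) ↔ LocallyRelated (coherentTopology C) s t x y := by
  let F := Regular.strongEpiMonoFactorisation (prod.lift s t)
  have : IsRegularEpi F.e := inferInstanceAs
    (IsRegularEpi (Regular.strongEpiMonoFactorisation (prod.lift s t)).e)
  have hs : F.e ≫ F.m ≫ prod.fst = s := by rw [F.fac_assoc, prod.lift_fst]
  have ht : F.e ≫ F.m ≫ prod.snd = t := by rw [F.fac_assoc, prod.lift_snd]
  have hE : JointlyMonic (F.m ≫ prod.fst) (F.m ≫ prod.snd) := fun W x y h₁ h₂ => by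
    rw [← cancel_mono F.m]
    ext
    · simpa using h₁
    · simpa using h₂
  refine ⟨F.I, F.m ≫ prod.fst, F.m ≫ prod.snd, hE, fun W x y => ⟨?_, fun h => ?_⟩⟩
  · rintro ⟨e, rfl, rfl⟩
    refine (locally_exists_lift F.e e).mono ?_
    rintro V v ⟨p, hp⟩
    refine ⟨p, ?_, ?_⟩
    · refine (congrArg (p ≫ ·) hs).symm.trans ?_
      simp only [← Category.assoc, hp]
    · refine (congrArg (p ≫ ·) ht).symm.trans ?_
      simp only [← Category.assoc, hp]
  · refine Locally.exists_lift_of_jointlyMonic hE (Locally.mono h ?_)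
    rintro V v ⟨p, hp, hp'⟩
    exact ⟨p ≫ F.e, by rw [Category.assoc, hs, hp], by rw [Category.assoc, ht, hp']⟩

theorem exists_effectiveEpi_of_isPullback [Regular C] {E X Q : C} {a b : E ⟶ X} {q : X ⟶ Q}
    (h : IsPullback a b q q) :
    ∃ (Q' : C) (q' : X ⟶ Q'), EffectiveEpi q' ∧
      ∀ ⦃W : C⦄ (x y : W ⟶ X), x ≫ q' = y ≫ q' ↔ ∃ e : W ⟶ E, e ≫ a = x ∧ e ≫ b = y := by
  let F := Regular.strongEpiMonoFactorisation q
  have : IsRegularEpi F.e := inferInstanceAs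
    (IsRegularEpi (Regular.strongEpiMonoFactorisation q).e)
  refine ⟨F.I, F.e, inferInstance, fun W x y => ⟨fun hxy => ?_, ?_⟩⟩
  · have hq : x ≫ q = y ≫ q := by
      rw [← F.fac, ← Category.assoc, hxy, Category.assoc]
    exact ⟨h.lift x y hq, by simp, by simp⟩
  · rintro ⟨e, rfl, rfl⟩
    rw [← cancel_mono F.m]
    simp [h.w]

theorem BarrExact.exists_quotient [HasFiniteLimits C] [FinitaryExtensive C] [Precoherent C]
    (hC : BarrExact C) {P X : C} (s t : P ⟶ X)
    (refl : ∀ ⦃W : C⦄ (x : W ⟶ X), LocallyRelated (coherentTopology C) s t x x)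
    (symm : ∀ ⦃W : C⦄ (x y : W ⟶ X), LocallyRelated (coherentTopology C) s t x y →
      LocallyRelated (coherentTopology C) s t y x)
    (trans : ∀ ⦃W : C⦄ (x y z : W ⟶ X), LocallyRelated (coherentTopology C) s t x y →
      LocallyRelated (coherentTopology C) s t y z → LocallyRelated (coherentTopology C) s t x z) :
    ∃ (Q : C) (q : X ⟶ Q), EffectiveEpi q ∧
      ∀ ⦃W : C⦄ (x y : W ⟶ X), x ≫ q = y ≫ q ↔ LocallyRelated (coherentTopology C) s t x y := by
  have := hC.regular
  obtain ⟨E, a, b, hE, hab⟩ := exists_jointlyMonic_image s t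
  have hr : IsEquivRelation a b :=
    ⟨hE, (hab _ _).2 (refl _), (hab _ _).2 (symm _ _ ((hab _ _).1 ⟨𝟙 E, by simp, by simp⟩)),
      (hab _ _).2 (trans _ (pullback.fst b a ≫ b) _ ((hab _ _).1 ⟨_, rfl, rfl⟩)
        ((hab _ _).1 ⟨_, pullback.condition.symm, rfl⟩))⟩
  obtain ⟨Q, q, hq⟩ := hC.2.2 a b hr
  obtain ⟨Q', q', hq', h⟩ := exists_effectiveEpi_of_isPullback hq
  exact ⟨Q', q', hq', fun W x y => (h x y).trans (hab x y)⟩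

end Quotient

/-! ### The equivalence relation generated by a Mal'cev span -/

section Malcev

variable {C : Type u} [Category.{v} C]

theorem IsMalcevSpan.exists_comp [HasFiniteLimits C] {Z A B : C} {f : Z ⟶ A} {g : Z ⟶ B}
    (H : IsMalcevSpan f g) {W : C} {x y z : W ⟶ Z} (hxy : x ≫ g = y ≫ g) (hyz : y ≫ f = z ≫ f) :
    ∃ p : W ⟶ Z, p ≫ f = x ≫ f ∧ p ≫ g = z ≫ g := by
  let l := pullback.snd g g ≫ f
  have hlim : IsTripleLimit f g (pullback.fst l f ≫ pullback.fst g g)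
      (pullback.fst l f ≫ pullback.snd g g) (pullback.snd l f) :=
    { w₁ := by simp [pullback.condition]
      w₂ := by simpa only [l, Category.assoc] using pullback.condition (f := l) (g := f)
      lift := fun X x₁ x₂ x₃ h₁ h₂ => by
        refine ⟨pullback.lift (pullback.lift x₁ x₂ h₁) x₃
          (by rwa [pullback.lift_snd_assoc]), ⟨?_, ?_, ?_⟩, ?_⟩
        · rw [pullback.lift_fst_assoc, pullback.lift_fst]
        · rw [pullback.lift_fst_assoc, pullback.lift_snd]
        · rw [pullback.lift_snd]
        · rintro u ⟨hu₁, hu₂, hu₃⟩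
          refine pullback.hom_ext (pullback.hom_ext ?_ ?_) ?_
          · rw [Category.assoc, hu₁, pullback.lift_fst, pullback.lift_fst]
          · rw [Category.assoc, hu₂, pullback.lift_fst, pullback.lift_snd]
          · rw [hu₃, pullback.lift_snd] }
  obtain ⟨p, hp, hp'⟩ := H.2 _ _ _ hlim
  obtain ⟨u, ⟨rfl, -, rfl⟩, -⟩ := hlim.lift x y z hxy hyz
  exact ⟨u ≫ p, by simp [hp], by simp [hp']⟩

section Relation

variable [HasFiniteCoproducts C] {Z A B : C} (f : Z ⟶ A) (g : Z ⟶ B)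

/-- `x` lies in the block of `A ⨿ B` that contains both images of `z`. -/
def InBlock {W : C} (x : W ⟶ A ⨿ B) (z : W ⟶ Z) : Prop :=
  (∃ z' : W ⟶ Z, z' ≫ f ≫ coprod.inl = x ∧ z' ≫ g = z ≫ g) ∨
    ∃ z' : W ⟶ Z, z' ≫ g ≫ coprod.inr = x ∧ z' ≫ f = z ≫ f

/-- `x` and `y` are equal or lie in a common block of `A ⨿ B`. -/
def BlockRelated {W : C} (x y : W ⟶ A ⨿ B) : Prop :=
  x = y ∨ ∃ z : W ⟶ Z, InBlock f g x z ∧ InBlock f g y z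

variable {f g}

theorem InBlock.comp {W V : C} {x : W ⟶ A ⨿ B} {z : W ⟶ Z} (h : InBlock f g x z) (v : V ⟶ W) :
    InBlock f g (v ≫ x) (v ≫ z) := by
  obtain ⟨z', rfl, e⟩ | ⟨z', rfl, e⟩ := h
  · exact Or.inl ⟨v ≫ z', by simp, by simp [e]⟩
  · exact Or.inr ⟨v ≫ z', by simp, by simp [e]⟩

theorem BlockRelated.comp {W V : C} {x y : W ⟶ A ⨿ B} (h : BlockRelated f g x y) (v : V ⟶ W) :
    BlockRelated f g (v ≫ x) (v ≫ y) :=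
  h.imp (congrArg (v ≫ ·)) fun ⟨z, hx, hy⟩ => ⟨v ≫ z, hx.comp v, hy.comp v⟩

theorem BlockRelated.symm {W : C} {x y : W ⟶ A ⨿ B} (h : BlockRelated f g x y) :
    BlockRelated f g y x :=
  h.imp Eq.symm fun ⟨z, hx, hy⟩ => ⟨z, hy, hx⟩

end Relation

variable [FinitaryExtensive C] {Z A B : C} {f : Z ⟶ A} {g : Z ⟶ B}

theorem InBlock.eq_of_inl {W : C} {a : W ⟶ A} {z : W ⟶ Z} (h : InBlock f g (a ≫ coprod.inl) z) :
    (∃ z' : W ⟶ Z, z' ≫ f = a ∧ z' ≫ g = z ≫ g) ∨ Nonempty (W ⟶ ⊥_ C) := by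
  obtain ⟨z', e, e'⟩ | ⟨z', e, e'⟩ := h
  · rw [← Category.assoc, cancel_mono] at e
    exact Or.inl ⟨z', e, e'⟩
  · rw [← Category.assoc] at e
    exact Or.inr (exists_hom_initial_of_inl_eq_inr e.symm)

theorem InBlock.eq_of_inr {W : C} {b : W ⟶ B} {z : W ⟶ Z} (h : InBlock f g (b ≫ coprod.inr) z) :
    (∃ z' : W ⟶ Z, z' ≫ g = b ∧ z' ≫ f = z ≫ f) ∨ Nonempty (W ⟶ ⊥_ C) := by
  obtain ⟨z', e, e'⟩ | ⟨z', e, e'⟩ := h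
  · rw [← Category.assoc] at e
    exact Or.inr (exists_hom_initial_of_inl_eq_inr e)
  · rw [← Category.assoc, cancel_mono] at e
    exact Or.inl ⟨z', e, e'⟩

/-- Two blocks of a Mal'cev span that meet are equal. -/
theorem IsMalcevSpan.inBlock_of_inBlock [HasFiniteLimits C] (H : IsMalcevSpan f g) {W : C} {x y : W ⟶ A ⨿ B}
    {z z' : W ⟶ Z} (hx : InBlock f g x z) (hy : InBlock f g y z) (hy' : InBlock f g y z') :
    InBlock f g x z' ∨ Nonempty (W ⟶ ⊥_ C) := by
  obtain ⟨c, rfl, hc⟩ | ⟨c, rfl, hc⟩ := hy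
  · rw [← Category.assoc] at hy'
    obtain ⟨c', hc', hcz⟩ | h := hy'.eq_of_inl
    · left
      obtain ⟨d, rfl, hd⟩ | ⟨d, rfl, hd⟩ := hx
      · obtain ⟨p, hp, hp'⟩ := H.exists_comp (hd.trans hc.symm) hc'.symm
        exact Or.inl ⟨p, by rw [← Category.assoc, hp, Category.assoc], hp'.trans hcz⟩
      · obtain ⟨p, hp, hp'⟩ := H.exists_comp hcz.symm hc'
        obtain ⟨r, hr, hr'⟩ := H.exists_comp (hp'.trans hc) hd.symm
        exact Or.inr ⟨r, by rw [← Category.assoc, hr', Category.assoc], hr.trans hp⟩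
    · exact Or.inr h
  · rw [← Category.assoc] at hy'
    obtain ⟨c', hc', hcz⟩ | h := hy'.eq_of_inr
    · left
      obtain ⟨d, rfl, hd⟩ | ⟨d, rfl, hd⟩ := hx
      · obtain ⟨p, hp, hp'⟩ := H.exists_comp hd hc.symm
        obtain ⟨r, hr, hr'⟩ := H.exists_comp (hp'.trans hc'.symm) hcz
        exact Or.inl ⟨r, by rw [← Category.assoc, hr, hp, Category.assoc], hr'⟩
      · obtain ⟨p, hp, hp'⟩ := H.exists_comp hc' (hc.trans hd.symm)
        exact Or.inr ⟨p, by rw [← Category.assoc, hp', Category.assoc], hp.trans hcz⟩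
    · exact Or.inr h

theorem IsMalcevSpan.locally_blockRelated_trans [HasFiniteLimits C] [Precoherent C]
    (H : IsMalcevSpan f g) {W : C}
    {x y z : W ⟶ A ⨿ B} (hxy : BlockRelated f g x y) (hyz : BlockRelated f g y z) :
    Locally (coherentTopology C) fun _ v => BlockRelated f g (v ≫ x) (v ≫ z) := by
  obtain rfl | ⟨c, hx, hy⟩ := hxy
  · exact .of_forall fun _ v => hyz.comp v
  · obtain rfl | ⟨c', hy', hz⟩ := hyz
    · exact .of_forall fun _ v => Or.inr ⟨v ≫ c, hx.comp v, hy.comp v⟩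
    · obtain h | ⟨⟨h⟩⟩ := H.inBlock_of_inBlock hx hy hy'
      · exact .of_forall fun _ v => Or.inr ⟨v ≫ c', h.comp v, hz.comp v⟩
      · exact locally_of_hom_initial h

/-- The block relation is locally generated by a parallel pair of morphisms. -/
theorem exists_locallyRelated_iff_blockRelated [HasFiniteLimits C] [Precoherent C] (f : Z ⟶ A)
    (g : Z ⟶ B) : ∃ (P : C) (s t : P ⟶ A ⨿ B), ∀ ⦃W : C⦄ (x y : W ⟶ A ⨿ B),
      LocallyRelated (coherentTopology C) s t x y ↔
        Locally (coherentTopology C) fun _ v => BlockRelated f g (v ≫ x) (v ≫ y) := by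
  let l : pullback g g ⨿ pullback f f ⟶ A ⨿ B :=
    coprod.desc (pullback.fst g g ≫ f ≫ coprod.inl) (pullback.fst f f ≫ g ≫ coprod.inr)
  let m : pullback g g ⨿ pullback f f ⟶ Z := coprod.desc (pullback.snd g g) (pullback.snd f f)
  have hl₁ : coprod.inl ≫ l = pullback.fst g g ≫ f ≫ coprod.inl := coprod.inl_desc _ _
  have hl₂ : coprod.inr ≫ l = pullback.fst f f ≫ g ≫ coprod.inr := coprod.inr_desc _ _
  have hm₁ : coprod.inl ≫ m = pullback.snd g g := coprod.inl_desc _ _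
  have hm₂ : coprod.inr ≫ m = pullback.snd f f := coprod.inr_desc _ _
  have lift : ∀ ⦃W : C⦄ {x : W ⟶ A ⨿ B} {z : W ⟶ Z}, InBlock f g x z →
      ∃ p, p ≫ l = x ∧ p ≫ m = z := by
    rintro W x z (⟨z', rfl, e⟩ | ⟨z', rfl, e⟩)
    · exact ⟨pullback.lift z' z e ≫ coprod.inl,
        by rw [Category.assoc, hl₁, pullback.lift_fst_assoc],
        by rw [Category.assoc, hm₁, pullback.lift_snd]⟩
    · exact ⟨pullback.lift z' z e ≫ coprod.inr,
        by rw [Category.assoc, hl₂, pullback.lift_fst_assoc],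
        by rw [Category.assoc, hm₂, pullback.lift_snd]⟩
  have inBlock : ∀ ⦃W : C⦄ (p : W ⟶ pullback g g ⨿ pullback f f),
      Locally (coherentTopology C) fun _ v => InBlock f g (v ≫ p ≫ l) (v ≫ p ≫ m) := by
    intro W p
    refine (locally_coprod p).mono ?_
    rintro V v (⟨a, ha⟩ | ⟨b, hb⟩)
    · rw [← Category.assoc, ← Category.assoc, ← ha, Category.assoc, Category.assoc, hl₁, hm₁]
      exact Or.inl ⟨a ≫ pullback.fst g g, by simp, by simp [pullback.condition]⟩
    · rw [← Category.assoc, ← Category.assoc, ← hb, Category.assoc, Category.assoc, hl₂, hm₂]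
      exact Or.inr ⟨b ≫ pullback.fst f f, by simp, by simp [pullback.condition]⟩
  let s : (A ⨿ B) ⨿ pullback m m ⟶ A ⨿ B := coprod.desc (𝟙 _) (pullback.fst m m ≫ l)
  let t : (A ⨿ B) ⨿ pullback m m ⟶ A ⨿ B := coprod.desc (𝟙 _) (pullback.snd m m ≫ l)
  have hs₁ : coprod.inl ≫ s = 𝟙 _ := coprod.inl_desc _ _
  have hs₂ : coprod.inr ≫ s = pullback.fst m m ≫ l := coprod.inr_desc _ _
  have ht₁ : coprod.inl ≫ t = 𝟙 _ := coprod.inl_desc _ _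
  have ht₂ : coprod.inr ≫ t = pullback.snd m m ≫ l := coprod.inr_desc _ _
  refine ⟨_, s, t, fun W x y => ⟨fun h => Locally.bind h ?_, fun h => Locally.mono h ?_⟩⟩
  · rintro V v ⟨p, hx, hy⟩
    refine (locally_coprod p).bind ?_
    rintro U u (⟨a, ha⟩ | ⟨b, hb⟩)
    · refine .of_forall fun U' u' => Or.inl ?_
      simp only [Category.assoc, ← hx, ← hy]
      rw [← Category.assoc u p, ← Category.assoc u p, ← ha]
      simp [hs₁, ht₁]
    · refine ((inBlock (b ≫ pullback.fst m m)).and (inBlock (b ≫ pullback.snd m m))).mono ?_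
      rintro U' u' ⟨h₁, h₂⟩
      refine Or.inr ⟨u' ≫ b ≫ pullback.fst m m ≫ m, ?_, ?_⟩
      · simp only [Category.assoc, ← hx]
        rw [← Category.assoc u p, ← hb]
        simpa [hs₂] using h₁
      · simp only [Category.assoc, ← hy]
        rw [← Category.assoc u p, ← hb, pullback.condition]
        simpa [ht₂] using h₂
  · rintro V v (e | ⟨z, hx, hy⟩)
    · exact ⟨(v ≫ x) ≫ coprod.inl, by simp [hs₁], by simp [ht₁, e]⟩
    · obtain ⟨p, hp, hpz⟩ := lift hx
      obtain ⟨p', hp', hpz'⟩ := lift hy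
      exact ⟨pullback.lift p p' (hpz.trans hpz'.symm) ≫ coprod.inr,
        by rw [Category.assoc, hs₂, pullback.lift_fst_assoc, hp],
        by rw [Category.assoc, ht₂, pullback.lift_snd_assoc, hp']⟩

theorem BlockRelated.of_inl {W : C} {x y : W ⟶ A}
    (h : BlockRelated f g (x ≫ coprod.inl) (y ≫ coprod.inl)) :
    (x = y ∨ ∃ z z' : W ⟶ Z, z ≫ f = x ∧ z' ≫ f = y ∧ z ≫ g = z' ≫ g) ∨
      Nonempty (W ⟶ ⊥_ C) := by
  obtain e | ⟨z, hx, hy⟩ := h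
  · exact Or.inl (Or.inl ((cancel_mono _).1 e))
  · obtain ⟨a, ha, ha'⟩ | h := hx.eq_of_inl
    · obtain ⟨b, hb, hb'⟩ | h := hy.eq_of_inl
      · exact Or.inl (Or.inr ⟨a, b, ha, hb, ha'.trans hb'.symm⟩)
      · exact Or.inr h
    · exact Or.inr h

theorem BlockRelated.of_inr {W : C} {x y : W ⟶ B}
    (h : BlockRelated f g (x ≫ coprod.inr) (y ≫ coprod.inr)) :
    (x = y ∨ ∃ z z' : W ⟶ Z, z ≫ g = x ∧ z' ≫ g = y ∧ z ≫ f = z' ≫ f) ∨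
      Nonempty (W ⟶ ⊥_ C) := by
  obtain e | ⟨z, hx, hy⟩ := h
  · exact Or.inl (Or.inl ((cancel_mono _).1 e))
  · obtain ⟨a, ha, ha'⟩ | h := hx.eq_of_inr
    · obtain ⟨b, hb, hb'⟩ | h := hy.eq_of_inr
      · exact Or.inl (Or.inr ⟨a, b, ha, hb, ha'.trans hb'.symm⟩)
      · exact Or.inr h
    · exact Or.inr h

theorem IsMalcevSpan.exists_of_blockRelated [HasFiniteLimits C] (H : IsMalcevSpan f g) {W : C}
    {x : W ⟶ A} {y : W ⟶ B} (h : BlockRelated f g (x ≫ coprod.inl) (y ≫ coprod.inr)) :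
    (∃ z : W ⟶ Z, z ≫ f = x ∧ z ≫ g = y) ∨ Nonempty (W ⟶ ⊥_ C) := by
  obtain e | ⟨z, hx, hy⟩ := h
  · exact Or.inr (exists_hom_initial_of_inl_eq_inr e)
  · obtain ⟨a, rfl, ha⟩ | h := hx.eq_of_inl
    · obtain ⟨b, rfl, hb⟩ | h := hy.eq_of_inr
      · exact Or.inl (H.exists_comp ha hb.symm)
      · exact Or.inr h
    · exact Or.inr h

theorem IsMalcevSpan.exists_isGlueing [HasFiniteLimits C] [Precoherent C] (hC : BarrExact C)
    (H : IsMalcevSpan f g) : ∃ (D : C) (h : A ⟶ D) (k : B ⟶ D),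
      IsGlueing (coherentTopology C) f g h k := by
  obtain ⟨P, s, t, hst⟩ := exists_locallyRelated_iff_blockRelated f g
  obtain ⟨Q, q, hq, hrel⟩ := hC.exists_quotient s t
    (fun W x => (hst _ _).2 (.of_forall fun _ _ => Or.inl rfl))
    (fun W x y h => (hst _ _).2 (((hst _ _).1 h).mono fun _ _ => BlockRelated.symm))
    (fun W x y z h h' => (hst _ _).2 ((((hst _ _).1 h).and ((hst _ _).1 h')).bind
      fun V v hv => by
        simpa only [Category.assoc] using H.locally_blockRelated_trans hv.1 hv.2))
  replace hrel : ∀ ⦃W : C⦄ (x y : W ⟶ A ⨿ B), x ≫ q = y ≫ q ↔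
      Locally (coherentTopology C) fun _ v => BlockRelated f g (v ≫ x) (v ≫ y) :=
    fun W x y => (hrel x y).trans (hst x y)
  refine ⟨Q, coprod.inl ≫ q, coprod.inr ≫ q, ?_, ?_, ?_, ?_, ?_⟩
  · rw [← Category.assoc, ← Category.assoc, hrel]
    exact .of_forall fun _ v => Or.inr ⟨v, Or.inl ⟨v, rfl, rfl⟩, Or.inr ⟨v, rfl, rfl⟩⟩
  · intro W d
    refine (locally_exists_lift q d).bind ?_
    rintro V v ⟨a, ha⟩
    refine (locally_coprod a).mono ?_
    rintro U u (⟨x, hx⟩ | ⟨y, hy⟩)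
    · exact Or.inl ⟨x, by rw [← Category.assoc, hx, Category.assoc, ha, Category.assoc]⟩
    · exact Or.inr ⟨y, by rw [← Category.assoc, hy, Category.assoc, ha, Category.assoc]⟩
  · intro W x y hxy
    rw [← Category.assoc, ← Category.assoc, hrel] at hxy
    refine hxy.bind fun V v hv => ?_
    rw [← Category.assoc, ← Category.assoc] at hv
    obtain (e | ⟨z, z', hz, hz', e⟩) | ⟨⟨h⟩⟩ := hv.of_inl
    · exact .of_forall fun _ u => Or.inl (by simp [e])
    · exact .of_forall fun _ u =>
        Or.inr ⟨u ≫ z, u ≫ z', by simp [hz], by simp [hz'], by simp [e]⟩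
    · exact locally_of_hom_initial h
  · intro W x y hxy
    rw [← Category.assoc, ← Category.assoc, hrel] at hxy
    refine hxy.bind fun V v hv => ?_
    rw [← Category.assoc, ← Category.assoc] at hv
    obtain (e | ⟨z, z', hz, hz', e⟩) | ⟨⟨h⟩⟩ := hv.of_inr
    · exact .of_forall fun _ u => Or.inl (by simp [e])
    · exact .of_forall fun _ u =>
        Or.inr ⟨u ≫ z, u ≫ z', by simp [hz], by simp [hz'], by simp [e]⟩
    · exact locally_of_hom_initial h
  · intro W x y hxy
    rw [← Category.assoc, ← Category.assoc, hrel] at hxy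
    refine Locally.exists_lift_of_jointlyMonic (J := coherentTopology C) H.1
      (hxy.bind fun V v hv => ?_)
    rw [← Category.assoc, ← Category.assoc] at hv
    obtain ⟨z, hz, hz'⟩ | ⟨⟨h⟩⟩ := H.exists_of_blockRelated hv
    · exact .of_forall fun _ u => ⟨u ≫ z, by simp [hz], by simp [hz']⟩
    · exact locally_of_hom_initial h

end Malcev

/-- Every pretopos (finitely complete, extensive and Barr-exact category)
is diexact. -/
theorem pretopos_diexact {C : Type u} [Category.{v} C] [HasFiniteLimits C]
    [FinitaryExtensive C] (hC : BarrExact C) : Diexact C := by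
  intro Z A B f g H
  have := hC.regular
  obtain ⟨D₀, h₀, k₀, G⟩ := H.exists_isGlueing hC
  refine ⟨⟨D₀, h₀, k₀, G.isPushout⟩, fun D h k hpo => ?_⟩
  have G' : IsGlueing (coherentTopology C) f g h k := by
    simpa using G.comp_iso (G.isPushout.isoIsPushout A B hpo)
  exact ⟨G'.pushoutStable, G'.isPullback H.1⟩
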